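/- Let 0 < β < 1/2 < γ < 1, T > 0, and let 0 = t_0 < t_1 < … < t_J = T be a partition of [0,T] with τ := max_{1≤j≤J} (t_j − t_{j−1}). Let v : [0,T] → ℝ be continuous with finite Gagliardo H^γ(0,T) norm, define the left-endpoint interpolant Q_τ v by (Q_τ v)(t) = v(t_{j−1}) for t ∈ [t_{j−1}, t_j), and let g : ℝ → ℝ equal v − Q_τ v on (0,T) and 0 outside (0,T). Then (∫_ℝ ∫_ℝ |g(s)−g(t)|²/|s−t|^{1+2β} ds dt)^{1/2} ≤ C τ^{γ−β} ‖v‖_{H^γ(0,T)}, where C depends only on β, γ and T. -/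

import Mathlib

open MeasureTheory

/-- Gagliardo seminorm `[v]_{H^s(0,T)}`. -/
noncomputable def gagliardoSemiT (T s : ℝ) (v : ℝ → ℝ) : ℝ :=
  Real.sqrt (∫ σ in Set.Ioo (0 : ℝ) T, ∫ t in Set.Ioo (0 : ℝ) T,
    (v σ - v t) ^ 2 / |σ - t| ^ (1 + 2 * s))

/-- The `H^s(0,T)` norm `(‖v‖²_{L²(0,T)} + [v]²_{H^s(0,T)})^(1/2)`. -/
noncomputable def sobNormT (T s : ℝ) (v : ℝ → ℝ) : ℝ :=
  Real.sqrt ((∫ t in Set.Ioo (0 : ℝ) T, (v t) ^ 2) + (gagliardoSemiT T s v) ^ 2)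

lemma aux_jensen (f : ℝ → ℝ) (hf : Continuous f) :
    ENNReal.ofReal ((∫ x in (0:ℝ)..1, f x) ^ 2) ≤
      ∫⁻ x in Set.Ioo (0:ℝ) 1, ENNReal.ofReal (f x ^ 2) := by
  have h1 : ∫⁻ x in Set.Ioo (0:ℝ) 1, ENNReal.ofReal (f x ^ 2)
      = ENNReal.ofReal (∫ x in (0:ℝ)..1, f x ^ 2) := by
    rw [intervalIntegral.integral_of_le zero_le_one, ← restrict_Ioo_eq_restrict_Ioc,
      ofReal_integral_eq_lintegral_ofReal]
    · exact ((hf.pow 2).integrableOn_Icc (a := 0) (b := 1)).mono_set Set.Ioo_subset_Icc_self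
    · exact Filter.Eventually.of_forall fun x => sq_nonneg _
  rw [h1]
  apply ENNReal.ofReal_le_ofReal
  set c := ∫ x in (0:ℝ)..1, f x with hc
  have h2 : 0 ≤ ∫ x in (0:ℝ)..1, (f x - c) ^ 2 :=
    intervalIntegral.integral_nonneg zero_le_one fun x _ => sq_nonneg _
  have h3 : ∫ x in (0:ℝ)..1, (f x - c) ^ 2 = (∫ x in (0:ℝ)..1, f x ^ 2) - 2 * c * c + c ^ 2 := by
    have : ∀ x, (f x - c) ^ 2 = f x ^ 2 - 2 * c * f x + c ^ 2 := fun x => by ring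
    simp_rw [this]
    rw [intervalIntegral.integral_add, intervalIntegral.integral_sub,
      intervalIntegral.integral_const_mul]
    · simp [← hc]
    all_goals exact Continuous.intervalIntegrable (by fun_prop) _ _
  nlinarith

lemma aux_cov (F : ℝ → ENNReal) (p d : ℝ) (hd : d ≠ 0) (E : Set ℝ)
    (hE : ∀ x ∈ Set.Ioo (0:ℝ) 1, p + d * x ∈ E) :
    ENNReal.ofReal |d| * ∫⁻ x in Set.Ioo (0:ℝ) 1, F (p + d * x) ≤ ∫⁻ x in E, F x := by
  have := lintegral_image_eq_lintegral_abs_deriv_mul (s := Set.Ioo (0:ℝ) 1)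
    (f := fun x => p + d * x) (f' := fun _ => d) measurableSet_Ioo
    (fun x _ => by
      simpa using (((hasDerivAt_id x).const_mul d).const_add p).hasDerivWithinAt)
    (fun x _ y _ h => by simpa [hd] using h) F
  rw [lintegral_const_mul' _ _ ENNReal.ofReal_ne_top] at this
  rw [← this]
  exact lintegral_mono_set (by rintro _ ⟨x, hx, rfl⟩; exact hE x hx)

noncomputable def kk (γ : ℝ) (v : ℝ → ℝ) (x y : ℝ) : ENNReal :=
  ENNReal.ofReal ((v x - v y) ^ 2 / |x - y| ^ (1 + 2 * γ))

lemma aux_pt (γ : ℝ) (hγ : 0 < γ) (v : ℝ → ℝ) (x y d : ℝ) (hd : |x - y| ≤ d) :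
    ENNReal.ofReal ((v x - v y) ^ 2) ≤ ENNReal.ofReal (d ^ (1 + 2 * γ)) * kk γ v x y := by
  have hd0 : 0 ≤ d := (abs_nonneg _).trans hd
  unfold kk
  rw [← ENNReal.ofReal_mul (by positivity)]
  apply ENNReal.ofReal_le_ofReal
  by_cases h : x = y
  · subst h; simp
  have h0 : 0 < |x - y| := abs_pos.2 (sub_ne_zero.2 h)
  have : |x - y| ^ (1 + 2 * γ) ≤ d ^ (1 + 2 * γ) :=
    Real.rpow_le_rpow h0.le hd (by positivity)
  have h1 : 0 < |x - y| ^ (1 + 2 * γ) := by positivity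
  rw [mul_div_assoc', le_div_iff₀ h1]
  nlinarith [sq_nonneg (v x - v y)]

noncomputable def avg (v : ℝ → ℝ) (p d : ℝ) : ℝ := ∫ x in (0:ℝ)..1, v (p + d * x)

lemma aux_step (γ : ℝ) (hγ : 0 < γ) (v : ℝ → ℝ) (hv : Continuous v) (p d : ℝ) (hd : d ≠ 0)
    (E : Set ℝ) (hE : ∀ x ∈ Set.Ioo (0:ℝ) 1, p + d * x ∈ E) :
    ENNReal.ofReal ((avg v p d - avg v p (d / 2)) ^ 2) ≤
      ENNReal.ofReal (2 * |d| ^ (2 * γ - 1)) * ∫⁻ x in E, ∫⁻ y in E, kk γ v x y := by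
  have hd' : 0 < |d| := abs_pos.2 hd
  have e1 : avg v p d - avg v p (d / 2)
      = ∫ x in (0:ℝ)..1, (v (p + d * x) - avg v p (d / 2)) := by
    rw [intervalIntegral.integral_sub]
    · simp [avg]
    all_goals exact Continuous.intervalIntegrable (by fun_prop) _ _
  have e2 : ∀ x, v (p + d * x) - avg v p (d / 2)
      = ∫ y in (0:ℝ)..1, (v (p + d * x) - v (p + d / 2 * y)) := by
    intro x
    rw [intervalIntegral.integral_sub]
    · simp [avg]
    all_goals exact Continuous.intervalIntegrable (by fun_prop) _ _
  have hE2 : ∀ x ∈ Set.Ioo (0:ℝ) 1, p + d / 2 * x ∈ E := by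
    intro x hx
    have := hE (x / 2) ⟨by linarith [hx.1], by linarith [hx.2, hx.1]⟩
    convert this using 1; ring
  set S := ∫⁻ x in E, ∫⁻ y in E, kk γ v x y
  set I := ∫⁻ x in Set.Ioo (0:ℝ) 1, ∫⁻ y in Set.Ioo (0:ℝ) 1, kk γ v (p + d * x) (p + d / 2 * y)
    with hI
  have b1 : ENNReal.ofReal ((avg v p d - avg v p (d / 2)) ^ 2) ≤
      ENNReal.ofReal (|d| ^ (1 + 2 * γ)) * I := by
    rw [e1]
    refine (aux_jensen _ (by fun_prop)).trans ?_
    rw [hI, ← lintegral_const_mul' _ _ ENNReal.ofReal_ne_top]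
    refine setLIntegral_mono' measurableSet_Ioo fun x hx => ?_
    rw [e2]
    refine (aux_jensen _ (by fun_prop)).trans ?_
    rw [← lintegral_const_mul' _ _ ENNReal.ofReal_ne_top]
    refine setLIntegral_mono' measurableSet_Ioo fun y hy => ?_
    refine aux_pt γ hγ v _ _ _ ?_
    have : p + d * x - (p + d / 2 * y) = d * (x - y / 2) := by ring
    rw [this, abs_mul]
    have : |x - y / 2| ≤ 1 := by
      rw [abs_le]; constructor <;> linarith [hx.1, hx.2, hy.1, hy.2]
    nlinarith
  have b2 : ENNReal.ofReal |d| * (ENNReal.ofReal |d / 2| * I) ≤ S := by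
    rw [hI, ← lintegral_const_mul' _ _ ENNReal.ofReal_ne_top]
    refine le_trans ?_ (aux_cov (fun x => ∫⁻ y in E, kk γ v x y) p d hd E hE)
    gcongr with x
    exact aux_cov _ p (d / 2) (by simpa using hd) E hE2
  refine b1.trans ?_
  calc ENNReal.ofReal (|d| ^ (1 + 2 * γ)) * I
      = ENNReal.ofReal (2 * |d| ^ (2 * γ - 1)) *
          (ENNReal.ofReal |d| * (ENNReal.ofReal |d / 2| * I)) := by
        rw [← mul_assoc, ← mul_assoc, ← ENNReal.ofReal_mul (by positivity),
          ← ENNReal.ofReal_mul (by positivity)]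
        congr 2
        rw [abs_div, abs_of_pos (two_pos : (0:ℝ) < 2)]
        have : |d| ^ (1 + 2 * γ) = |d| ^ (2 * γ - 1) * |d| ^ (2:ℝ) := by
          rw [← Real.rpow_add hd']; congr 1; ring
        rw [this, Real.rpow_two]
        ring
    _ ≤ _ := by gcongr

lemma aux_chain (γ : ℝ) (hγ : 1 / 2 < γ) (v : ℝ → ℝ) (hv : Continuous v) (p d : ℝ) (hd : d ≠ 0)
    (E : Set ℝ) (hE : ∀ x ∈ Set.Ioo (0:ℝ) 1, p + d * x ∈ E)
    (hS : ∫⁻ x in E, ∫⁻ y in E, kk γ v x y ≠ ⊤) :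
    |avg v p d - v p| ≤ √(2 * |d| ^ (2 * γ - 1) * (∫⁻ x in E, ∫⁻ y in E, kk γ v x y).toReal)
      / (1 - (1 / 2 : ℝ) ^ (γ - 1 / 2)) := by
  set S := ∫⁻ x in E, ∫⁻ y in E, kk γ v x y with hSdef
  set r : ℝ := (1 / 2 : ℝ) ^ (γ - 1 / 2) with hr
  have hr0 : 0 < r := by positivity
  have hr1 : r < 1 := Real.rpow_lt_one (by norm_num) (by norm_num) (by linarith)
  set f : ℕ → ℝ := fun n => avg v p (d * (1 / 2) ^ n) with hf
  have hcont : Continuous (fun d => avg v p d) := by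
    unfold avg
    exact intervalIntegral.continuous_parametric_intervalIntegral_of_continuous' (by fun_prop) _ _
  have hlim : Filter.Tendsto f Filter.atTop (nhds (v p)) := by
    have h1 : Filter.Tendsto (fun n : ℕ => d * (1 / 2 : ℝ) ^ n) Filter.atTop (nhds 0) := by
      simpa using (tendsto_pow_atTop_nhds_zero_of_lt_one (r := (1/2:ℝ)) (by norm_num)
        (by norm_num)).const_mul d
    have h2 := (hcont.tendsto 0).comp h1
    have h3 : avg v p 0 = v p := by simp [avg]
    rw [h3] at h2
    exact h2
  have hstep : ∀ n, dist (f n) (f (n + 1)) ≤ √(2 * |d| ^ (2 * γ - 1) * S.toReal) * r ^ n := by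
    intro n
    have hn : d * (1 / 2 : ℝ) ^ n ≠ 0 := by positivity
    have hpow1 : (1 / 2 : ℝ) ^ n ≤ 1 := pow_le_one₀ (by norm_num) (by norm_num)
    have hpow0 : 0 < (1 / 2 : ℝ) ^ n := by positivity
    have := aux_step γ (by linarith) v hv p (d * (1 / 2) ^ n) hn E (fun x hx => by
      rw [mul_assoc]
      exact hE _ ⟨by have := hx.1; positivity, by nlinarith [hx.1, hx.2]⟩)
    rw [← hSdef, ← ENNReal.ofReal_toReal hS, ← ENNReal.ofReal_mul (by positivity),
      ENNReal.ofReal_le_ofReal_iff (by positivity)] at this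
    have e : d * (1 / 2) ^ n / 2 = d * (1 / 2) ^ (n + 1) := by ring
    rw [e] at this
    rw [Real.dist_eq]
    apply le_of_sq_le_sq _ (by positivity)
    rw [sq_abs, mul_pow, Real.sq_sqrt (by positivity)]
    refine this.trans (le_of_eq ?_)
    have : |d * (1 / 2) ^ n| ^ (2 * γ - 1) = |d| ^ (2 * γ - 1) * (r ^ n) ^ 2 := by
      rw [abs_mul, Real.mul_rpow (by positivity) (by positivity), abs_of_pos hpow0]
      congr 1
      rw [hr, ← Real.rpow_natCast, ← Real.rpow_natCast, ← Real.rpow_natCast, ← Real.rpow_mul,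
        ← Real.rpow_mul, ← Real.rpow_mul]
      · congr 1; push_cast; ring
      all_goals positivity
    rw [this]; ring
  have := dist_le_of_le_geometric_of_tendsto₀ r _ hr1 hstep hlim
  simpa [hf, Real.dist_eq] using this

lemma aux_morrey (γ : ℝ) (hγ : 1 / 2 < γ) (v : ℝ → ℝ) (hv : Continuous v) (a b s : ℝ)
    (has : a ≤ s) (hsb : s ≤ b) :
    ENNReal.ofReal ((v s - v a) ^ 2) ≤
      ENNReal.ofReal (8 / (1 - (1 / 2 : ℝ) ^ (γ - 1 / 2)) ^ 2 * (b - a) ^ (2 * γ - 1)) *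
        ∫⁻ x in Set.Ico a b, ∫⁻ y in Set.Ico a b, kk γ v x y := by
  rcases has.eq_or_lt with rfl | has
  · simp
  set E := Set.Ico a b
  set S := ∫⁻ x in E, ∫⁻ y in E, kk γ v x y with hSdef
  set r : ℝ := (1 / 2 : ℝ) ^ (γ - 1 / 2) with hr
  have hr0 : 0 < r := by positivity
  have hr1 : r < 1 := Real.rpow_lt_one (by norm_num) (by norm_num) (by linarith)
  have hr2 : 0 < 1 - r := by linarith
  have hba : 0 < b - a := by linarith
  by_cases hS : S = ⊤
  · rw [hS, ENNReal.mul_top]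
    · exact le_top
    · simp only [ne_eq, ENNReal.ofReal_eq_zero, not_le]; positivity
  have hsa : 0 < s - a := by linarith
  have h1 := aux_chain γ hγ v hv a (s - a) hsa.ne' E (fun x hx =>
    ⟨by nlinarith [hx.1, hx.2], by nlinarith [hx.1, hx.2]⟩) hS
  have h2 := aux_chain γ hγ v hv s (-(s - a)) (by linarith) E (fun x hx =>
    ⟨by nlinarith [hx.1, hx.2], by nlinarith [hx.1, hx.2]⟩) hS
  have h3 : avg v s (-(s - a)) = avg v a (s - a) := by
    unfold avg
    have := intervalIntegral.integral_comp_sub_left (a := 0) (b := 1)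
      (fun x => v (a + (s - a) * x)) 1
    simp only [sub_self, sub_zero] at this
    rw [← this]
    congr 1; ext x; congr 1; ring
  rw [h3, abs_neg] at h2
  rw [← hSdef, ← hr, abs_of_pos hsa] at h1 h2
  set Q := √(2 * (s - a) ^ (2 * γ - 1) * S.toReal) with hQ
  have h4 : |v s - v a| ≤ 2 * (Q / (1 - r)) := by
    have e : v s - v a = (avg v a (s - a) - v a) - (avg v a (s - a) - v s) := by ring
    rw [e]
    refine (abs_sub _ _).trans ?_
    linarith
  have h5 : (v s - v a) ^ 2 ≤ 8 / (1 - r) ^ 2 * (s - a) ^ (2 * γ - 1) * S.toReal := by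
    rw [← sq_abs]
    have h6 : |v s - v a| ^ 2 ≤ (2 * (Q / (1 - r))) ^ 2 := by gcongr
    refine h6.trans (le_of_eq ?_)
    rw [mul_pow, div_pow, hQ, Real.sq_sqrt (by positivity)]
    ring
  rw [← ENNReal.ofReal_toReal hS, ← ENNReal.ofReal_mul (by positivity)]
  apply ENNReal.ofReal_le_ofReal
  refine h5.trans ?_
  have : (s - a) ^ (2 * γ - 1) ≤ (b - a) ^ (2 * γ - 1) :=
    Real.rpow_le_rpow hsa.le (by linarith) (by linarith)
  gcongr

lemma aux_tail (β c : ℝ) (hβ : 0 < β) (hc : 0 < c) :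
    ∫⁻ x in Set.Ioi c, ENNReal.ofReal (1 / |x| ^ (1 + 2 * β))
      = ENNReal.ofReal (c ^ (-(2 * β)) / (2 * β)) := by
  have h1 : ∫⁻ x in Set.Ioi c, ENNReal.ofReal (1 / |x| ^ (1 + 2 * β))
      = ∫⁻ x in Set.Ioi c, ENNReal.ofReal (x ^ (-(1 + 2 * β))) := by
    refine setLIntegral_congr_fun measurableSet_Ioi fun x hx => ?_
    have hx0 : 0 < x := hc.trans hx
    rw [abs_of_pos hx0, Real.rpow_neg hx0.le, one_div]
  rw [h1, ← ofReal_integral_eq_lintegral_ofReal]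
  · rw [integral_Ioi_rpow_of_lt (by linarith) hc]
    congr 1
    have : -(1 + 2 * β) + 1 = -(2 * β) := by ring
    rw [this, neg_div_neg_eq]
  · exact integrableOn_Ioi_rpow_of_lt (by linarith) hc
  · filter_upwards [ae_restrict_mem measurableSet_Ioi] with x hx
    exact Real.rpow_nonneg (hc.trans hx).le _

lemma aux_head (β h : ℝ) (hβ : β < 1 / 2) (hh : 0 < h) :
    ∫⁻ x in Set.Ioo 0 h, ENNReal.ofReal (x ^ (-(2 * β)))
      = ENNReal.ofReal (h ^ (1 - 2 * β) / (1 - 2 * β)) := by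
  rw [← ofReal_integral_eq_lintegral_ofReal]
  · rw [restrict_Ioo_eq_restrict_Ioc, ← intervalIntegral.integral_of_le hh.le,
      integral_rpow (Or.inl (by linarith))]
    congr 1
    have : -(2 * β) + 1 = 1 - 2 * β := by ring
    rw [this, Real.zero_rpow (by linarith), sub_zero]
  · have := (intervalIntegral.intervalIntegrable_rpow' (a := 0) (b := h) (r := -(2 * β))
      (by linarith)).1
    exact this.mono_set Set.Ioo_subset_Ioc_self
  · filter_upwards [ae_restrict_mem measurableSet_Ioo] with x hx
    exact Real.rpow_nonneg hx.1.le _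

lemma aux_img (e p : ℝ) (he : |e| = 1) (E : Set ℝ) (hE : MeasurableSet E) (F : ℝ → ENNReal) :
    ∫⁻ x in (fun x => p + e * x) '' E, F x = ∫⁻ x in E, F (p + e * x) := by
  have he0 : e ≠ 0 := by rintro rfl; simp at he
  have := lintegral_image_eq_lintegral_abs_deriv_mul (s := E)
    (f := fun x => p + e * x) (f' := fun _ => e) hE
    (fun x _ => by
      simpa using (((hasDerivAt_id x).const_mul e).const_add p).hasDerivWithinAt)
    (fun x _ y _ h => by simpa [he0] using h) F
  simpa [he] using this

noncomputable def kr (β : ℝ) (x y : ℝ) : ENNReal := ENNReal.ofReal (1 / |x - y| ^ (1 + 2 * β))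

lemma aux_perim (β a b : ℝ) (hβ0 : 0 < β) (hβ : β < 1 / 2) (hab : a < b) :
    ∫⁻ s in Set.Ico a b, ∫⁻ u in (Set.Ico a b)ᶜ, kr β s u ≤
      ENNReal.ofReal ((b - a) ^ (1 - 2 * β) / (β * (1 - 2 * β))) := by
  have hin : ∀ s ∈ Set.Ioo a b, ∫⁻ u in (Set.Ico a b)ᶜ, kr β s u ≤
      ENNReal.ofReal (1 / (2 * β)) * ENNReal.ofReal ((s - a) ^ (-(2 * β))) +
      ENNReal.ofReal (1 / (2 * β)) * ENNReal.ofReal ((b - s) ^ (-(2 * β))) := by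
    intro s hs
    have hsa : 0 < s - a := by linarith [hs.1]
    have hsb : 0 < b - s := by linarith [hs.2]
    have e1 : ∫⁻ u in Set.Iio a, kr β s u = ENNReal.ofReal ((s - a) ^ (-(2 * β)) / (2 * β)) := by
      rw [← aux_tail β _ hβ0 hsa]
      have : Set.Iio a = (fun x => s + (-1) * x) '' Set.Ioi (s - a) := by
        ext x
        simp only [Set.mem_Iio, Set.mem_image, Set.mem_Ioi]
        exact ⟨fun h => ⟨s - x, by linarith, by ring⟩, by rintro ⟨y, hy, rfl⟩; linarith⟩
      rw [this, aux_img _ _ (by simp) _ measurableSet_Ioi]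
      simp [kr]
    have e2 : ∫⁻ u in Set.Ioi b, kr β s u = ENNReal.ofReal ((b - s) ^ (-(2 * β)) / (2 * β)) := by
      rw [← aux_tail β _ hβ0 hsb]
      have : Set.Ioi b = (fun x => s + 1 * x) '' Set.Ioi (b - s) := by
        ext x
        simp only [Set.mem_image, Set.mem_Ioi]
        exact ⟨fun h => ⟨x - s, by linarith, by ring⟩, by rintro ⟨y, hy, rfl⟩; linarith⟩
      rw [this, aux_img _ _ (by simp) _ measurableSet_Ioi]
      simp [kr]
    have hsub : (Set.Ico a b)ᶜ ⊆ Set.Iio a ∪ Set.Ici b := by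
      intro x hx
      simp only [Set.mem_compl_iff, Set.mem_Ico, not_and, not_lt] at hx
      by_cases h : a ≤ x
      · exact Or.inr (hx h)
      · exact Or.inl (not_le.1 h)
    refine (lintegral_mono_set hsub).trans ((lintegral_union_le _ _ _).trans ?_)
    rw [← Measure.restrict_congr_set (Ioi_ae_eq_Ici (μ := volume) (a := b)), e1, e2, ← ENNReal.ofReal_mul (by positivity),
      ← ENNReal.ofReal_mul (by positivity)]
    rw [one_div_mul_eq_div, one_div_mul_eq_div]
  have hba : 0 < b - a := by linarith
  have f1 : ∫⁻ s in Set.Ioo a b, ENNReal.ofReal ((s - a) ^ (-(2 * β)))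
      = ENNReal.ofReal ((b - a) ^ (1 - 2 * β) / (1 - 2 * β)) := by
    rw [← aux_head β _ hβ hba]
    have : Set.Ioo a b = (fun x => a + 1 * x) '' Set.Ioo 0 (b - a) := by
      ext x
      simp only [Set.mem_image, Set.mem_Ioo]
      exact ⟨fun h => ⟨x - a, ⟨by linarith, by linarith⟩, by ring⟩,
        by rintro ⟨y, hy, rfl⟩; constructor <;> linarith⟩
    rw [this, aux_img _ _ (by simp) _ measurableSet_Ioo]
    simp
  have f2 : ∫⁻ s in Set.Ioo a b, ENNReal.ofReal ((b - s) ^ (-(2 * β)))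
      = ENNReal.ofReal ((b - a) ^ (1 - 2 * β) / (1 - 2 * β)) := by
    rw [← aux_head β _ hβ hba]
    have : Set.Ioo a b = (fun x => b + (-1) * x) '' Set.Ioo 0 (b - a) := by
      ext x
      simp only [Set.mem_image, Set.mem_Ioo]
      exact ⟨fun h => ⟨b - x, ⟨by linarith, by linarith⟩, by ring⟩,
        by rintro ⟨y, hy, rfl⟩; constructor <;> linarith⟩
    rw [this, aux_img _ _ (by simp) _ measurableSet_Ioo]
    simp
  have h12 : 0 < 1 - 2 * β := by linarith
  rw [← restrict_Ioo_eq_restrict_Ico]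
  refine (setLIntegral_mono' measurableSet_Ioo hin).trans ?_
  rw [lintegral_add_left (by fun_prop), lintegral_const_mul' _ _ ENNReal.ofReal_ne_top,
    lintegral_const_mul' _ _ ENNReal.ofReal_ne_top, f1, f2, ← ENNReal.ofReal_mul (by positivity),
    ← ENNReal.ofReal_add (by positivity) (by positivity)]
  apply le_of_eq
  congr 1
  field_simp
  ring

lemma aux_mono (t : ℕ → ℝ) (n : ℕ) (ht : ∀ i < n, t i < t (i + 1)) : t 0 ≤ t n := by
  induction n with
  | zero => rfl
  | succ n ih => exact (ih fun i hi => ht i (by omega)).trans (ht n (by omega)).le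

lemma aux_mem (t : ℕ → ℝ) (n : ℕ) (s : ℝ) (hs : s ∈ Set.Ico (t 0) (t n)) :
    ∃ j < n, s ∈ Set.Ico (t j) (t (j + 1)) := by
  induction n with
  | zero => simp at hs
  | succ n ih =>
    by_cases h : s < t n
    · obtain ⟨j, hj, h⟩ := ih ⟨hs.1, h⟩
      exact ⟨j, by omega, h⟩
    · exact ⟨n, by omega, not_lt.1 h, hs.2⟩

lemma aux_sum (t : ℕ → ℝ) (n : ℕ) (ht : ∀ i < n, t i < t (i + 1)) (F : ℝ → ENNReal) :
    ∑ j ∈ Finset.range n, ∫⁻ x in Set.Ico (t j) (t (j + 1)), F x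
      = ∫⁻ x in Set.Ico (t 0) (t n), F x := by
  induction n with
  | zero => simp
  | succ n ih =>
    have h0 := aux_mono t n fun i hi => ht i (by omega)
    rw [Finset.sum_range_succ, ih fun i hi => ht i (by omega),
      ← Set.Ico_union_Ico_eq_Ico h0 (ht n (by omega)).le,
      lintegral_union measurableSet_Ico]
    rw [Set.disjoint_left]
    intro x hx hx'
    exact absurd hx.2 (not_lt.2 hx'.1)

lemma aux_meas_kk (γ : ℝ) (w : ℝ → ℝ) (hw : Continuous w) :
    Measurable (fun p : ℝ × ℝ => kk γ w p.1 p.2) := by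
  have := hw.measurable
  unfold kk
  fun_prop

lemma aux_meas_kr (β : ℝ) : Measurable (fun p : ℝ × ℝ => kr β p.1 p.2) := by
  unfold kr
  fun_prop

lemma aux_same (β γ τ : ℝ) (hβ0 : 0 < β) (hβγ : β < γ) (w : ℝ → ℝ) (s u : ℝ)
    (h : |s - u| ≤ τ) :
    kk β w s u ≤ ENNReal.ofReal (τ ^ (2 * γ - 2 * β)) * kk γ w s u := by
  have hτ : 0 ≤ τ := (abs_nonneg _).trans h
  unfold kk
  rw [← ENNReal.ofReal_mul (by positivity)]
  apply ENNReal.ofReal_le_ofReal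
  by_cases hsu : s = u
  · subst hsu; simp
  have h0 : 0 < |s - u| := abs_pos.2 (sub_ne_zero.2 hsu)
  have e : |s - u| ^ (1 + 2 * γ) = |s - u| ^ (1 + 2 * β) * |s - u| ^ (2 * γ - 2 * β) := by
    rw [← Real.rpow_add h0]; congr 1; ring
  have h1 : |s - u| ^ (2 * γ - 2 * β) ≤ τ ^ (2 * γ - 2 * β) :=
    Real.rpow_le_rpow h0.le h (by linarith)
  have hA : 0 < |s - u| ^ (1 + 2 * β) := by positivity
  have hB : 0 < |s - u| ^ (2 * γ - 2 * β) := by positivity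
  rw [e, mul_div_assoc', div_le_div_iff₀ hA (by positivity)]
  have := mul_le_mul_of_nonneg_left h1 (mul_nonneg (sq_nonneg (w s - w u)) hA.le)
  nlinarith

lemma aux_main (β γ : ℝ) (hβ0 : 0 < β) (hβ : β < 1 / 2) (hγ : 1 / 2 < γ)
    (J : ℕ) (t : ℕ → ℝ) (τ : ℝ) (w g : ℝ → ℝ) (hw : Continuous w)
    (ht : ∀ i < J, t i < t (i + 1)) (hτ : ∀ i < J, t (i + 1) - t i ≤ τ)
    (hg0 : ∀ s, s ∉ Set.Ico (t 0) (t J) → g s = 0)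
    (hg : ∀ j < J, ∀ s ∈ Set.Ico (t j) (t (j + 1)), g s = w s - w (t j)) :
    ∫⁻ s, ∫⁻ u, kk β g s u ≤
      ENNReal.ofReal ((1 + 4 * (8 / (1 - (1 / 2 : ℝ) ^ (γ - 1 / 2)) ^ 2) / (β * (1 - 2 * β)))
        * τ ^ (2 * γ - 2 * β)) *
      ∫⁻ s in Set.Ico (t 0) (t J), ∫⁻ u in Set.Ico (t 0) (t J), kk γ w s u := by
  set c : ℝ := 8 / (1 - (1 / 2 : ℝ) ^ (γ - 1 / 2)) ^ 2 with hc
  have hc0 : 0 ≤ c := by positivity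
  have h12 : 0 < 1 - 2 * β := by linarith
  set I : ℕ → Set ℝ := fun j => Set.Ico (t j) (t (j + 1)) with hI
  have hIm : ∀ j, MeasurableSet (I j) := fun j => measurableSet_Ico
  set S : ℕ → ENNReal := fun j => ∫⁻ x in I j, ∫⁻ y in I j, kk γ w x y with hS
  set N : ℕ → ENNReal := fun j =>
    ENNReal.ofReal (c * (t (j + 1) - t j) ^ (2 * γ - 1)) * S j with hN
  have hgN : ∀ j < J, ∀ s ∈ I j, ENNReal.ofReal (g s ^ 2) ≤ N j := by
    intro j hj s hs
    rw [hg j hj s hs]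
    exact aux_morrey γ hγ w hw _ _ s hs.1 hs.2.le
  set A : ℕ → ℝ × ℝ → ENNReal := fun j => (I j ×ˢ I j).indicator
    (fun p => ENNReal.ofReal (τ ^ (2 * γ - 2 * β)) * kk γ w p.1 p.2) with hA
  set B : ℕ → ℝ × ℝ → ENNReal := fun j => (I j ×ˢ (I j)ᶜ).indicator
    (fun p => 2 * N j * kr β p.1 p.2) with hB
  set D : ℕ → ℝ × ℝ → ENNReal := fun j => ((I j)ᶜ ×ˢ I j).indicator
    (fun p => 2 * N j * kr β p.1 p.2) with hD
  have hkk := aux_meas_kk γ w hw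
  have hkr := aux_meas_kr β
  have hAm : ∀ j, Measurable (A j) := fun j =>
    (hkk.const_mul _).indicator ((hIm j).prod (hIm j))
  have hBm : ∀ j, Measurable (B j) := fun j =>
    (hkr.const_mul _).indicator ((hIm j).prod (hIm j).compl)
  have hDm : ∀ j, Measurable (D j) := fun j =>
    (hkr.const_mul _).indicator ((hIm j).compl.prod (hIm j))
  have hpt : ∀ s u, kk β g s u ≤ ∑ j ∈ Finset.range J, (A j (s, u) + B j (s, u) + D j (s, u)) := by
    intro s u
    by_cases hsame : ∃ j < J, s ∈ I j ∧ u ∈ I j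
    · obtain ⟨j, hj, hs, hu⟩ := hsame
      have h1 : kk β g s u = kk β w s u := by
        unfold kk
        rw [hg j hj s hs, hg j hj u hu]
        congr 3; ring
      have h2 : |s - u| ≤ τ := by
        have := hτ j hj
        rw [abs_le]
        constructor <;> linarith [hs.1, hs.2, hu.1, hu.2]
      calc kk β g s u ≤ A j (s, u) := by
            rw [h1, hA]
            simp only
            rw [Set.indicator_of_mem (Set.mk_mem_prod hs hu)]
            exact aux_same β γ τ hβ0 (by linarith) w s u h2
        _ ≤ A j (s, u) + B j (s, u) + D j (s, u) := by
            rw [add_assoc]; exact le_self_add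
        _ ≤ _ := Finset.single_le_sum (f := fun j => A j (s, u) + B j (s, u) + D j (s, u))
            (fun _ _ => zero_le) (Finset.mem_range.2 hj)
    · have hs : ENNReal.ofReal (2 * g s ^ 2) * kr β s u ≤ ∑ j ∈ Finset.range J, B j (s, u) := by
        by_cases hs : s ∈ Set.Ico (t 0) (t J)
        · obtain ⟨j, hj, hsj⟩ := aux_mem t J s hs
          have huj : u ∉ I j := fun h => hsame ⟨j, hj, hsj, h⟩
          refine le_trans ?_ (Finset.single_le_sum (f := fun j => B j (s, u))
            (fun _ _ => zero_le) (Finset.mem_range.2 hj))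
          rw [hB]
          simp only
          rw [Set.indicator_of_mem (Set.mk_mem_prod hsj huj), ENNReal.ofReal_mul zero_le_two]
          gcongr
          · simp
          · exact hgN j hj s hsj
        · simp [hg0 s hs]
      have hu : ENNReal.ofReal (2 * g u ^ 2) * kr β s u ≤ ∑ j ∈ Finset.range J, D j (s, u) := by
        by_cases hs : u ∈ Set.Ico (t 0) (t J)
        · obtain ⟨j, hj, hsj⟩ := aux_mem t J u hs
          have huj : s ∉ I j := fun h => hsame ⟨j, hj, h, hsj⟩
          refine le_trans ?_ (Finset.single_le_sum (f := fun j => D j (s, u))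
            (fun _ _ => zero_le) (Finset.mem_range.2 hj))
          rw [hD]
          simp only
          rw [Set.indicator_of_mem (Set.mk_mem_prod (show s ∈ (I j)ᶜ from huj) hsj),
            ENNReal.ofReal_mul zero_le_two]
          gcongr
          · simp
          · exact hgN j hj u hsj
        · simp [hg0 u hs]
      have h1 : kk β g s u ≤ ENNReal.ofReal (2 * g s ^ 2) * kr β s u
          + ENNReal.ofReal (2 * g u ^ 2) * kr β s u := by
        unfold kk kr
        rw [← add_mul, ← ENNReal.ofReal_add (by positivity) (by positivity),
          ← ENNReal.ofReal_mul (by positivity), mul_one_div]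
        apply ENNReal.ofReal_le_ofReal
        gcongr
        nlinarith [sq_nonneg (g s + g u)]
      refine h1.trans ((add_le_add hs hu).trans ?_)
      rw [← Finset.sum_add_distrib]
      refine Finset.sum_le_sum fun j _ => ?_
      rw [add_assoc]
      exact le_add_self
  have hIA : ∀ j, ∫⁻ p, A j p ∂(volume.prod volume)
      = ENNReal.ofReal (τ ^ (2 * γ - 2 * β)) * S j := by
    intro j
    rw [hA]
    simp only
    rw [lintegral_indicator ((hIm j).prod (hIm j)), lintegral_const_mul _ hkk,
      setLIntegral_prod _ hkk.aemeasurable]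
  have hIB : ∀ j < J, ∫⁻ p, B j p ∂(volume.prod volume) ≤ 2 * N j *
      ENNReal.ofReal ((t (j + 1) - t j) ^ (1 - 2 * β) / (β * (1 - 2 * β))) := by
    intro j hj
    rw [hB]
    simp only
    rw [lintegral_indicator ((hIm j).prod (hIm j).compl), lintegral_const_mul _ hkr,
      setLIntegral_prod _ hkr.aemeasurable]
    gcongr
    exact aux_perim β _ _ hβ0 hβ (ht j hj)
  have hID : ∀ j < J, ∫⁻ p, D j p ∂(volume.prod volume) ≤ 2 * N j *
      ENNReal.ofReal ((t (j + 1) - t j) ^ (1 - 2 * β) / (β * (1 - 2 * β))) := by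
    intro j hj
    rw [hD]
    simp only
    rw [lintegral_indicator ((hIm j).compl.prod (hIm j)), lintegral_const_mul _ hkr,
      setLIntegral_prod_symm _ hkr.aemeasurable]
    gcongr
    refine le_trans (le_of_eq ?_) (aux_perim β _ _ hβ0 hβ (ht j hj))
    simp only [kr, abs_sub_comm]
    rfl
  have hNb : ∀ j < J, 2 * N j *
      ENNReal.ofReal ((t (j + 1) - t j) ^ (1 - 2 * β) / (β * (1 - 2 * β))) ≤
      ENNReal.ofReal (2 * c / (β * (1 - 2 * β)) * τ ^ (2 * γ - 2 * β)) * S j := by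
    intro j hj
    have hh : 0 < t (j + 1) - t j := by linarith [ht j hj]
    have e : (t (j + 1) - t j) ^ (2 * γ - 2 * β)
        = (t (j + 1) - t j) ^ (2 * γ - 1) * (t (j + 1) - t j) ^ (1 - 2 * β) := by
      rw [← Real.rpow_add hh]; congr 1; ring
    have hle : (t (j + 1) - t j) ^ (2 * γ - 2 * β) ≤ τ ^ (2 * γ - 2 * β) :=
      Real.rpow_le_rpow hh.le (hτ j hj) (by linarith)
    rw [hN]
    simp only
    have h2 : (2 : ENNReal) = ENNReal.ofReal 2 := by simp
    calc _ = ENNReal.ofReal (2 * (c * (t (j + 1) - t j) ^ (2 * γ - 1)) *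
            ((t (j + 1) - t j) ^ (1 - 2 * β) / (β * (1 - 2 * β)))) * S j := by
          rw [ENNReal.ofReal_mul (p := 2 * _) (by positivity),
            ENNReal.ofReal_mul (p := 2) (by positivity), ← h2]
          ring
      _ ≤ _ := by
          refine mul_le_mul_left (ENNReal.ofReal_le_ofReal ?_) _
          have : 2 * (c * (t (j + 1) - t j) ^ (2 * γ - 1)) *
            ((t (j + 1) - t j) ^ (1 - 2 * β) / (β * (1 - 2 * β)))
            = 2 * c / (β * (1 - 2 * β)) * (t (j + 1) - t j) ^ (2 * γ - 2 * β) := by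
              rw [e]; ring
          rw [this]
          gcongr
  have hSsum : ∑ j ∈ Finset.range J, S j ≤
      ∫⁻ s in Set.Ico (t 0) (t J), ∫⁻ u in Set.Ico (t 0) (t J), kk γ w s u := by
    rw [← aux_sum t J ht (fun s => ∫⁻ u in Set.Ico (t 0) (t J), kk γ w s u)]
    refine Finset.sum_le_sum fun j hj => ?_
    refine lintegral_mono fun s => ?_
    rw [← aux_sum t J ht (fun u => kk γ w s u)]
    exact Finset.single_le_sum (f := fun j => ∫⁻ y in I j, kk γ w s y)
      (fun _ _ => zero_le) hj
  calc ∫⁻ s, ∫⁻ u, kk β g s u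
      ≤ ∫⁻ s, ∫⁻ u, ∑ j ∈ Finset.range J, (A j (s, u) + B j (s, u) + D j (s, u)) :=
        lintegral_mono fun s => lintegral_mono fun u => hpt s u
    _ = ∫⁻ p, ∑ j ∈ Finset.range J, (A j p + B j p + D j p) ∂(volume.prod volume) := by
        rw [lintegral_prod]
        exact (Finset.measurable_sum _ fun j _ =>
          ((hAm j).add (hBm j)).add (hDm j)).aemeasurable
    _ = ∑ j ∈ Finset.range J, (∫⁻ p, A j p ∂(volume.prod volume) +
          ∫⁻ p, B j p ∂(volume.prod volume) + ∫⁻ p, D j p ∂(volume.prod volume)) := by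
        have hm : ∀ j, Measurable fun p => A j p + B j p + D j p :=
          fun j => ((hAm j).add (hBm j)).add (hDm j)
        rw [lintegral_finsetSum _ fun j _ => hm j]
        refine Finset.sum_congr rfl fun j _ => ?_
        rw [lintegral_add_right _ (hDm j), lintegral_add_left (hAm j)]
    _ ≤ ∑ j ∈ Finset.range J, ENNReal.ofReal ((1 + 4 * c / (β * (1 - 2 * β)))
        * τ ^ (2 * γ - 2 * β)) * S j := by
        refine Finset.sum_le_sum fun j hj => ?_
        have hj := Finset.mem_range.1 hj
        have hτ0 : 0 ≤ τ := by linarith [ht j hj, hτ j hj]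
        rw [hIA]
        refine (add_le_add (add_le_add le_rfl ((hIB j hj).trans (hNb j hj)))
          ((hID j hj).trans (hNb j hj))).trans (le_of_eq ?_)
        rw [← add_mul, ← add_mul, ← ENNReal.ofReal_add (by positivity) (by positivity),
          ← ENNReal.ofReal_add (by positivity) (by positivity)]
        congr 2
        ring
    _ ≤ _ := by
        rw [← Finset.mul_sum]
        gcongr

/-- Paper's Lemma 4.1, estimate for `I - Q_τ`: for a partition `0 = t 0 < … < t J = T`
with maximum step `τ`, a continuous `v` with finite `H^γ(0,T)` norm, and `g` the zero
extension of `v - Q_τ v` (where `(Q_τ v)(s) = v (t (j-1))` on `[t (j-1), t j)`), one has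
`[g]_{H^β(ℝ)} ≤ C τ^(γ-β) ‖v‖_{H^γ(0,T)}` with `C = C(β, γ, T)`. -/
theorem stmt_9 (β γ T : ℝ) (hβ0 : 0 < β) (hβ : β < 1 / 2) (hγ1 : 1 / 2 < γ)
    (hγ2 : γ < 1) (hT : 0 < T) :
    ∃ C : ℝ, 0 < C ∧ ∀ (J : ℕ) (t : ℕ → ℝ) (τ : ℝ) (v g : ℝ → ℝ),
      1 ≤ J → t 0 = 0 → t J = T → (∀ i < J, t i < t (i + 1)) →
      IsGreatest {d : ℝ | ∃ j, 1 ≤ j ∧ j ≤ J ∧ d = t j - t (j - 1)} τ →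
      ContinuousOn v (Set.Icc 0 T) →
      IntegrableOn (fun p : ℝ × ℝ => (v p.1 - v p.2) ^ 2 / |p.1 - p.2| ^ (1 + 2 * γ))
        (Set.Ioo 0 T ×ˢ Set.Ioo 0 T) →
      (∀ s, s ∉ Set.Ioo (0 : ℝ) T → g s = 0) →
      (∀ j, 1 ≤ j → j ≤ J → ∀ s ∈ Set.Ico (t (j - 1)) (t j),
        s ∈ Set.Ioo (0 : ℝ) T → g s = v s - v (t (j - 1))) →
      Real.sqrt (∫ s : ℝ, ∫ u : ℝ, (g s - g u) ^ 2 / |s - u| ^ (1 + 2 * β)) ≤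
        C * τ ^ (γ - β) * sobNormT T γ v := by
  set c : ℝ := 8 / (1 - (1 / 2 : ℝ) ^ (γ - 1 / 2)) ^ 2 with hc
  have hc0 : 0 ≤ c := by positivity
  have h12 : 0 < 1 - 2 * β := by linarith
  set K : ℝ := 1 + 4 * c / (β * (1 - 2 * β)) with hK
  have hK0 : 0 < K := by positivity
  refine ⟨√K, by positivity, ?_⟩
  intro J t τ v g hJ ht0 htJ ht hτ hv hfinite hg0 hg
  set w : ℝ → ℝ := Set.IccExtend hT.le (Set.domRestrict (Set.Icc 0 T) v) with hwdef
  have hw : Continuous w := (continuousOn_iff_continuous_domRestrict.1 hv).Icc_extend'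
  have hwv : ∀ s ∈ Set.Icc 0 T, w s = v s := by
    intro s hs
    rw [hwdef, Set.IccExtend_of_mem _ _ hs]
    rfl
  have hτi : ∀ i < J, t (i + 1) - t i ≤ τ := fun i hi =>
    hτ.2 ⟨i + 1, by omega, by omega, by simp⟩
  have htT : ∀ j < J, 0 ≤ t j ∧ t (j + 1) ≤ T := by
    intro j hj
    constructor
    · rw [← ht0]; exact aux_mono t j fun i hi => ht i (by omega)
    · rw [← htJ]
      have := aux_mono (fun i => t (j + 1 + i)) (J - (j + 1)) fun i hi => ht _ (by omega)
      simpa [show j + 1 + (J - (j + 1)) = J by omega] using this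
  have hτ0 : 0 < τ := lt_of_lt_of_le (by linarith [ht 0 (by omega)]) (hτi 0 (by omega))
  have hmain := aux_main β γ hβ0 hβ hγ1 J t τ w g hw ht hτi
    (by
      intro s hs
      apply hg0
      rw [ht0, htJ] at hs
      exact fun h => hs (Set.Ioo_subset_Ico_self h))
    (by
      intro j hj s hs
      obtain ⟨h0, h1⟩ := htT j hj
      rw [hwv s ⟨h0.trans hs.1, hs.2.le.trans h1⟩,
        hwv (t j) ⟨h0, (ht j hj).le.trans h1⟩]
      by_cases hs0 : s ∈ Set.Ioo 0 T
      · have := hg (j + 1) (by omega) (by omega) s (by simpa using hs) hs0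
        simpa using this
      · rw [hg0 s hs0]
        have hs' : s = 0 := by
          by_contra hne
          exact hs0 ⟨lt_of_le_of_ne (h0.trans hs.1) (Ne.symm hne), hs.2.trans_le h1⟩
        have : t j = 0 := le_antisymm (hs' ▸ hs.1) h0
        rw [this, hs']; simp)
  rw [ht0, htJ, ← hc, ← hK] at hmain
  set G : ℝ := ∫ σ in Set.Ioo (0 : ℝ) T, ∫ t in Set.Ioo (0 : ℝ) T,
    (v σ - v t) ^ 2 / |σ - t| ^ (1 + 2 * γ) with hG
  have hG0 : 0 ≤ G := integral_nonneg fun s => integral_nonneg fun u => by positivity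
  have hSG : ∫⁻ s in Set.Ico 0 T, ∫⁻ u in Set.Ico 0 T, kk γ w s u = ENNReal.ofReal G := by
    have e1 : G = ∫ p in Set.Ioo 0 T ×ˢ Set.Ioo 0 T,
        (v p.1 - v p.2) ^ 2 / |p.1 - p.2| ^ (1 + 2 * γ) ∂(volume.prod volume) := by
      rw [setIntegral_prod _ hfinite]
    have hfinite' := hfinite
    rw [IntegrableOn, Measure.volume_eq_prod] at hfinite'
    rw [e1, ofReal_integral_eq_lintegral_ofReal hfinite'
      (Filter.Eventually.of_forall fun p => by positivity),
      setLIntegral_prod _ (by exact hfinite'.1.aemeasurable.ennreal_ofReal),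
      ← restrict_Ioo_eq_restrict_Ico]
    refine setLIntegral_congr_fun measurableSet_Ioo fun s hs => ?_
    refine setLIntegral_congr_fun measurableSet_Ioo fun u hu => ?_
    simp only [kk]
    rw [hwv s (Set.Ioo_subset_Icc_self hs), hwv u (Set.Ioo_subset_Icc_self hu)]
  rw [hSG, ← ENNReal.ofReal_mul (by positivity)] at hmain
  set X : ℝ := ∫ s : ℝ, ∫ u : ℝ, (g s - g u) ^ 2 / |s - u| ^ (1 + 2 * β) with hX
  have hX0 : 0 ≤ X := integral_nonneg fun s => integral_nonneg fun u => by positivity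
  have hXle : ENNReal.ofReal X ≤ ∫⁻ s, ∫⁻ u, kk β g s u := by
    rw [← Real.enorm_of_nonneg hX0]
    refine (enorm_integral_le_lintegral_enorm _).trans ?_
    refine lintegral_mono fun s => ?_
    refine (enorm_integral_le_lintegral_enorm _).trans ?_
    refine lintegral_mono fun u => ?_
    rw [Real.enorm_of_nonneg (by positivity)]
    rfl
  have hfin : X ≤ K * τ ^ (2 * γ - 2 * β) * G := by
    rw [← ENNReal.ofReal_le_ofReal_iff (by positivity)]
    exact hXle.trans hmain
  have hL0 : 0 ≤ ∫ t in Set.Ioo (0 : ℝ) T, (v t) ^ 2 := integral_nonneg fun s => sq_nonneg _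
  have hτsq : τ ^ (2 * γ - 2 * β) = (τ ^ (γ - β)) ^ 2 := by
    rw [← Real.rpow_natCast, ← Real.rpow_mul hτ0.le]; congr 1; push_cast; ring
  unfold sobNormT gagliardoSemiT
  rw [← hG, Real.sq_sqrt hG0]
  apply Real.sqrt_le_iff.2
  refine ⟨by positivity, ?_⟩
  rw [mul_pow, mul_pow, Real.sq_sqrt hK0.le, Real.sq_sqrt (by positivity), ← hτsq]
  refine hfin.trans ?_
  gcongr
  linarith
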